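/- arXiv:2409.16269 — 8 statements merged into one kernel-verified Lean document; each statement's English description precedes it below -/
import Mathlib

section
/- The four sets Ω0 := {(ρ,y,z) ∈ ℝ³ : ρ > 0, z > 0}, Ω1 := {(ρ,y,z) ∈ ℝ³ : ρ > 0, w_min ≤ y/ρ ≤ w_max, c_min ≤ z/ρ ≤ c_max}, Ω2 := {(ρ,y,z) ∈ ℝ³ : ρ > 0, z > 0, v(U) ≥ v_min}, and Ω := Ω1 ∩ Ω2 are all convex subsets of ℝ³. -/
noncomputable def press (vref γ κ ρ z : ℝ) : ℝ :=
  if 0 < γ then vref / γ * z ^ κ * ρ ^ (γ - κ) else vref * Real.log ρ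

noncomputable def pRho (vref γ κ ρ z : ℝ) : ℝ :=
  if 0 < γ then vref / γ * (γ - κ) * z ^ κ * ρ ^ (γ - κ - 1) else vref / ρ

noncomputable def pZ (vref γ κ ρ z : ℝ) : ℝ :=
  if 0 < γ then vref / γ * κ * z ^ (κ - 1) * ρ ^ (γ - κ) else 0

noncomputable def vel (vref γ κ : ℝ) (U : ℝ × ℝ × ℝ) : ℝ :=
  U.2.1 / U.1 - press vref γ κ U.1 U.2.2

noncomputable def flux (vref γ κ : ℝ) (U : ℝ × ℝ × ℝ) : ℝ × ℝ × ℝ :=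
  vel vref γ κ U • U

noncomputable def sfun (vref γ κ ρ z : ℝ) : ℝ :=
  ρ ^ 2 * pRho vref γ κ ρ z + ρ * z * pZ vref γ κ ρ z

def dot3 (a b : ℝ × ℝ × ℝ) : ℝ := a.1 * b.1 + a.2.1 * b.2.1 + a.2.2 * b.2.2

noncomputable def nvec (vref γ κ vmin ρ z : ℝ) : ℝ × ℝ × ℝ :=
  (-(vmin + press vref γ κ ρ z + ρ * pRho vref γ κ ρ z), 1, -(ρ * pZ vref γ κ ρ z))

noncomputable def abar (vref γ κ : ℝ) (U : ℝ × ℝ × ℝ) : ℝ :=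
  vel vref γ κ U + |U.1 * pRho vref γ κ U.1 U.2.2 + U.2.2 * pZ vref γ κ U.1 U.2.2|

noncomputable def astd (vref γ κ : ℝ) (Uh Uc : ℝ × ℝ × ℝ) : ℝ :=
  max (abar vref γ κ Uh) (abar vref γ κ Uc)

noncomputable def rho1 (Uh Uc : ℝ × ℝ × ℝ) : ℝ := (Uh.1 + Uc.1) / 2

noncomputable def rho2 (vref γ κ : ℝ) (Uh Uc : ℝ × ℝ × ℝ) : ℝ :=
  rho1 Uh Uc + (Uh.1 * vel vref γ κ Uh - Uc.1 * vel vref γ κ Uc) / (2 * astd vref γ κ Uh Uc)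

noncomputable def zet1 (Uh Uc : ℝ × ℝ × ℝ) : ℝ := (Uh.2.2 + Uc.2.2) / 2

noncomputable def zet2 (vref γ κ : ℝ) (Uh Uc : ℝ × ℝ × ℝ) : ℝ :=
  zet1 Uh Uc + (Uh.2.2 * vel vref γ κ Uh - Uc.2.2 * vel vref γ κ Uc) / (2 * astd vref γ κ Uh Uc)

noncomputable def sbar (vref γ κ : ℝ) (Uh Uc : ℝ × ℝ × ℝ) : ℝ :=
  sSup ((fun q : ℝ × ℝ => sfun vref γ κ q.1 q.2) ''
    (Set.Icc (min (rho1 Uh Uc) (rho2 vref γ κ Uh Uc)) (max (rho1 Uh Uc) (rho2 vref γ κ Uh Uc)) ×ˢ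
     Set.Icc (min (zet1 Uh Uc) (zet2 vref γ κ Uh Uc)) (max (zet1 Uh Uc) (zet2 vref γ κ Uh Uc))))

noncomputable def amax (vref γ κ : ℝ) (Uh Uc : ℝ × ℝ × ℝ) : ℝ :=
  max (astd vref γ κ Uh Uc)
    (max (|vel vref γ κ Uh| + sbar vref γ κ Uh Uc / Uh.1)
         (|vel vref γ κ Uc| + sbar vref γ κ Uh Uc / Uc.1))

noncomputable def SGLF (vref γ κ α : ℝ) (U1 U2 : ℝ × ℝ × ℝ) : ℝ × ℝ × ℝ :=
  (1/2 : ℝ) • (U1 + α⁻¹ • flux vref γ κ U1 + U2 - α⁻¹ • flux vref γ κ U2)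

theorem convex_density_pos_wave_pos : Convex ℝ {U : ℝ × ℝ × ℝ | 0 < U.1 ∧ 0 < U.2.2} := by
  rintro ⟨r, y, z⟩ ⟨hr, hz⟩ ⟨r', y', z'⟩ ⟨hr', hz'⟩ a b ha hb hab
  exact ⟨convex_Ioi (0 : ℝ) hr hr' ha hb hab, convex_Ioi (0 : ℝ) hz hz' ha hb hab⟩

theorem convex_ratio_bounds (wmin wmax cmin cmax : ℝ) :
    Convex ℝ {U : ℝ × ℝ × ℝ | 0 < U.1 ∧ wmin ≤ U.2.1 / U.1 ∧ U.2.1 / U.1 ≤ wmax ∧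
      cmin ≤ U.2.2 / U.1 ∧ U.2.2 / U.1 ≤ cmax} := by
  rintro ⟨r, y, z⟩ ⟨hr, h1, h2, h3, h4⟩ ⟨r', y', z'⟩ ⟨hr', h1', h2', h3', h4'⟩ a b ha hb hab
  have hpos : 0 < a * r + b * r' := convex_Ioi (0 : ℝ) hr hr' ha hb hab
  simp only [le_div_iff₀ hr, div_le_iff₀ hr, le_div_iff₀ hr', div_le_iff₀ hr'] at *
  simp only [Set.mem_ofPred_eq, Prod.smul_mk, Prod.mk_add_mk, smul_eq_mul,
    le_div_iff₀ hpos, div_le_iff₀ hpos]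
  refine ⟨hpos, ?_, ?_, ?_, ?_⟩
  · linarith [mul_le_mul_of_nonneg_left h1 ha, mul_le_mul_of_nonneg_left h1' hb]
  · linarith [mul_le_mul_of_nonneg_left h2 ha, mul_le_mul_of_nonneg_left h2' hb]
  · linarith [mul_le_mul_of_nonneg_left h3 ha, mul_le_mul_of_nonneg_left h3' hb]
  · linarith [mul_le_mul_of_nonneg_left h4 ha, mul_le_mul_of_nonneg_left h4' hb]

/-- The tangent plane of `s ^ κ * t ^ (-m)` at `(1, 1)` lies below its graph. -/
theorem tangent_le_rpow_mul_rpow_neg {κ m s t : ℝ} (hm : 0 ≤ m) (hκ : m + 1 ≤ κ)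
    (hs : 0 < s) (ht : 0 < t) :
    1 + κ * (s - 1) - m * (t - 1) ≤ s ^ κ * t ^ (-m) := by
  have hκ0 : 0 < κ := by linarith
  have amgm := Real.geom_mean_le_arith_mean3_weighted (w₁ := 1 / κ) (w₂ := m / κ)
    (w₃ := (κ - 1 - m) / κ) (p₁ := s ^ κ * t ^ (-m)) (p₂ := t) (p₃ := 1)
    (by positivity) (by positivity) (div_nonneg (by linarith) hκ0.le)
    (by positivity) ht.le zero_le_one (by field_simp; ring)
  have hgeom : (s ^ κ * t ^ (-m)) ^ (1 / κ) * t ^ (m / κ) = s := by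
    rw [Real.mul_rpow (by positivity) (by positivity), ← Real.rpow_mul hs.le,
      ← Real.rpow_mul ht.le, mul_assoc, ← Real.rpow_add ht]
    have h1 : κ * (1 / κ) = 1 := by field_simp
    have h2 : -m * (1 / κ) + m / κ = 0 := by ring
    rw [h1, h2, Real.rpow_one, Real.rpow_zero, mul_one]
  rw [hgeom, Real.one_rpow, mul_one] at amgm
  have h := mul_le_mul_of_nonneg_left amgm hκ0.le
  have hexp : κ * (1 / κ * (s ^ κ * t ^ (-m)) + m / κ * t + (κ - 1 - m) / κ * 1)
      = s ^ κ * t ^ (-m) + m * t + (κ - 1 - m) := by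
    field_simp
  rw [hexp] at h
  linarith

theorem rpow_mul_rpow_neg_convex_comb_le {κ m z r z' r' a b : ℝ} (hm : 0 ≤ m) (hκ : m + 1 ≤ κ)
    (hz : 0 < z) (hr : 0 < r) (hz' : 0 < z') (hr' : 0 < r')
    (ha : 0 ≤ a) (hb : 0 ≤ b) (hab : a + b = 1) :
    (a * z + b * z') ^ κ * (a * r + b * r') ^ (-m)
      ≤ a * (z ^ κ * r ^ (-m)) + b * (z' ^ κ * r' ^ (-m)) := by
  have hz₀ : 0 < a * z + b * z' := convex_Ioi (0 : ℝ) hz hz' ha hb hab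
  have hr₀ : 0 < a * r + b * r' := convex_Ioi (0 : ℝ) hr hr' ha hb hab
  set z₀ := a * z + b * z' with hz₀_def
  set r₀ := a * r + b * r' with hr₀_def
  have key : ∀ x q : ℝ, 0 < x → 0 < q →
      z₀ ^ κ * r₀ ^ (-m) * (1 + κ * (x / z₀ - 1) - m * (q / r₀ - 1)) ≤ x ^ κ * q ^ (-m) := by
    intro x q hx hq
    have h := mul_le_mul_of_nonneg_left
      (tangent_le_rpow_mul_rpow_neg hm hκ (div_pos hx hz₀) (div_pos hq hr₀))
      (show 0 ≤ z₀ ^ κ * r₀ ^ (-m) by positivity)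
    rw [Real.div_rpow hx.le hz₀.le, Real.div_rpow hq.le hr₀.le] at h
    refine h.trans_eq ?_
    have := (Real.rpow_pos_of_pos hz₀ κ).ne'
    have := (Real.rpow_pos_of_pos hr₀ (-m)).ne'
    field_simp
  have hzsum : a * (z / z₀) + b * (z' / z₀) = 1 := by
    rw [← mul_div_assoc, ← mul_div_assoc, ← add_div, ← hz₀_def, div_self hz₀.ne']
  have hrsum : a * (r / r₀) + b * (r' / r₀) = 1 := by
    rw [← mul_div_assoc, ← mul_div_assoc, ← add_div, ← hr₀_def, div_self hr₀.ne']
  refine le_trans (le_of_eq ?_) (add_le_add (mul_le_mul_of_nonneg_left (key z r hz hr) ha)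
    (mul_le_mul_of_nonneg_left (key z' r' hz' hr') hb))
  linear_combination (z₀ ^ κ * r₀ ^ (-m)) * (-κ * hzsum + m * hrsum - (1 - κ + m) * hab)

theorem mul_press_eq_of_pos {vref γ κ r z : ℝ} (hγ : 0 < γ) (hr : 0 < r) :
    r * press vref γ κ r z = vref / γ * (z ^ κ * r ^ (-(κ - γ - 1))) := by
  rw [press, if_pos hγ, show -(κ - γ - 1) = (γ - κ) + 1 by ring, Real.rpow_add_one hr.ne']
  ring

theorem convexOn_mul_press {vref γ κ : ℝ} (hvref : 0 < vref) (hκ : γ + 1 ≤ κ) :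
    ConvexOn ℝ {U : ℝ × ℝ × ℝ | 0 < U.1 ∧ 0 < U.2.2}
      (fun U => U.1 * press vref γ κ U.1 U.2.2) := by
  refine ⟨convex_density_pos_wave_pos, ?_⟩
  rintro ⟨r, y, z⟩ ⟨hr, hz⟩ ⟨r', y', z'⟩ ⟨hr', hz'⟩ a b ha hb hab
  simp only [Prod.smul_mk, Prod.mk_add_mk, smul_eq_mul] at *
  have hpos : 0 < a * r + b * r' := convex_Ioi (0 : ℝ) hr hr' ha hb hab
  by_cases hγ : 0 < γ
  · rw [mul_press_eq_of_pos hγ hr, mul_press_eq_of_pos hγ hr', mul_press_eq_of_pos hγ hpos]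
    have h := mul_le_mul_of_nonneg_left
      (rpow_mul_rpow_neg_convex_comb_le (κ := κ) (m := κ - γ - 1) (by linarith) (by linarith)
        hz hr hz' hr' ha hb hab) (div_pos hvref hγ).le
    linarith
  · simp only [press, if_neg hγ]
    have h := mul_le_mul_of_nonneg_left
      (Real.convexOn_mul_log.2 (Set.mem_Ici.2 hr.le) (Set.mem_Ici.2 hr'.le) ha hb hab) hvref.le
    simp only [smul_eq_mul] at h
    linarith

theorem le_vel_iff {vref γ κ vmin : ℝ} {U : ℝ × ℝ × ℝ} (hr : 0 < U.1) :
    vmin ≤ vel vref γ κ U ↔ U.1 * press vref γ κ U.1 U.2.2 ≤ U.2.1 - vmin * U.1 := by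
  rw [vel, le_sub_iff_add_le, le_div_iff₀ hr]
  constructor <;> intro h <;> linarith

theorem convex_velocity_ge {vref γ κ : ℝ} (vmin : ℝ) (hvref : 0 < vref) (hκ : γ + 1 ≤ κ) :
    Convex ℝ {U : ℝ × ℝ × ℝ | 0 < U.1 ∧ 0 < U.2.2 ∧ vmin ≤ vel vref γ κ U} := by
  rintro U ⟨hr, hz, hv⟩ V ⟨hr', hz', hv'⟩ a b ha hb hab
  obtain ⟨hpos, hpos'⟩ := convex_density_pos_wave_pos ⟨hr, hz⟩ ⟨hr', hz'⟩ ha hb hab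
  refine ⟨hpos, hpos', (le_vel_iff hpos).2 ?_⟩
  refine ((convexOn_mul_press hvref hκ).2 ⟨hr, hz⟩ ⟨hr', hz'⟩ ha hb hab).trans ?_
  have h := mul_le_mul_of_nonneg_left ((le_vel_iff hr).1 hv) ha
  have h' := mul_le_mul_of_nonneg_left ((le_vel_iff hr').1 hv') hb
  simp only [smul_eq_mul, Prod.fst_add, Prod.snd_add, Prod.smul_fst, Prod.smul_snd]
  linarith

theorem stmt_0 (vref γ κ vmin wmin wmax cmin cmax : ℝ)
    (hvref : 0 < vref) (hγ : 0 ≤ γ) (hκ : γ + 1 ≤ κ)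
    (hw : wmin ≤ wmax) (hc : cmin ≤ cmax) :
    Convex ℝ {U : ℝ × ℝ × ℝ | 0 < U.1 ∧ 0 < U.2.2} ∧
    Convex ℝ {U : ℝ × ℝ × ℝ | 0 < U.1 ∧ wmin ≤ U.2.1 / U.1 ∧ U.2.1 / U.1 ≤ wmax ∧
        cmin ≤ U.2.2 / U.1 ∧ U.2.2 / U.1 ≤ cmax} ∧
    Convex ℝ {U : ℝ × ℝ × ℝ | 0 < U.1 ∧ 0 < U.2.2 ∧ vmin ≤ vel vref γ κ U} ∧
    Convex ℝ ({U : ℝ × ℝ × ℝ | 0 < U.1 ∧ wmin ≤ U.2.1 / U.1 ∧ U.2.1 / U.1 ≤ wmax ∧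
        cmin ≤ U.2.2 / U.1 ∧ U.2.2 / U.1 ≤ cmax} ∩
      {U : ℝ × ℝ × ℝ | 0 < U.1 ∧ 0 < U.2.2 ∧ vmin ≤ vel vref γ κ U}) := by
  exact ⟨convex_density_pos_wave_pos, convex_ratio_bounds wmin wmax cmin cmax,
    convex_velocity_ge vmin hvref hκ,
    (convex_ratio_bounds wmin wmax cmin cmax).inter (convex_velocity_ge vmin hvref hκ)⟩
end

section
/- The function η(ρ,z) := ρ·(v_min + p(ρ,z)) is convex on the open positive quadrant {(ρ,z) ∈ ℝ² : ρ > 0, z > 0}. -/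
theorem convex_posQuadrant : Convex ℝ {q : ℝ × ℝ | 0 < q.1 ∧ 0 < q.2} :=
  (convex_Ioi (0 : ℝ)).prod (convex_Ioi (0 : ℝ))

/-- The perspective `(ρ, z) ↦ ρ * φ (z / ρ)` of a convex function `φ` is convex. -/
theorem ConvexOn.perspective {φ : ℝ → ℝ} (hφ : ConvexOn ℝ (Set.Ioi 0) φ) :
    ConvexOn ℝ {q : ℝ × ℝ | 0 < q.1 ∧ 0 < q.2} (fun q => q.1 * φ (q.2 / q.1)) := by
  refine ⟨convex_posQuadrant, ?_⟩
  rintro ⟨ρ₁, z₁⟩ ⟨h₁, k₁⟩ ⟨ρ₂, z₂⟩ ⟨h₂, k₂⟩ s t hs ht hst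
  simp only [Prod.smul_mk, Prod.mk_add_mk, smul_eq_mul] at *
  have hρ : 0 < s * ρ₁ + t * ρ₂ := convex_Ioi (0 : ℝ) h₁ h₂ hs ht hst
  have key := hφ.2 (div_pos k₁ h₁) (div_pos k₂ h₂)
    (div_nonneg (mul_nonneg hs h₁.le) hρ.le) (div_nonneg (mul_nonneg ht h₂.le) hρ.le)
    (by rw [← add_div, div_self hρ.ne'])
  simp only [smul_eq_mul] at key
  have hz : s * ρ₁ / (s * ρ₁ + t * ρ₂) * (z₁ / ρ₁) + t * ρ₂ / (s * ρ₁ + t * ρ₂) * (z₂ / ρ₂)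
      = (s * z₁ + t * z₂) / (s * ρ₁ + t * ρ₂) := by
    field_simp
  rw [hz] at key
  calc _ ≤ _ := mul_le_mul_of_nonneg_left key hρ.le
    _ = _ := by field_simp

theorem convexOn_rpow_mul_rpow_neg {κ c : ℝ} (hc : 1 ≤ c) (hκ : c ≤ κ) :
    ConvexOn ℝ {q : ℝ × ℝ | 0 < q.1 ∧ 0 < q.2} (fun q => q.2 ^ κ * q.1 ^ (c - κ)) := by
  have c_pos : 0 < c := by linarith
  have hconv := ((convexOn_rpow ((one_le_div c_pos).2 hκ)).subset
    Set.Ioi_subset_Ici_self (convex_Ioi 0)).perspective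
  have hpow : ConvexOn ℝ {q : ℝ × ℝ | 0 < q.1 ∧ 0 < q.2}
      (fun q => (q.1 * (q.2 / q.1) ^ (κ / c)) ^ c) := by
    refine ⟨hconv.1, fun x hx y hy s t hs ht hst => ?_⟩
    have hpos : ∀ q : ℝ × ℝ, 0 < q.1 ∧ 0 < q.2 → 0 ≤ q.1 * (q.2 / q.1) ^ (κ / c) :=
      fun q hq => mul_nonneg hq.1.le (Real.rpow_nonneg (div_pos hq.2 hq.1).le _)
    exact (Real.rpow_le_rpow (hpos _ (hconv.1 hx hy hs ht hst))
      (hconv.2 hx hy hs ht hst) c_pos.le).trans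
      ((convexOn_rpow hc).2 (hpos x hx) (hpos y hy) hs ht hst)
  refine hpow.congr fun q ⟨hρ, hz⟩ => ?_
  have hdiv := div_pos hz hρ
  dsimp only
  rw [Real.mul_rpow hρ.le (Real.rpow_nonneg hdiv.le _), ← Real.rpow_mul hdiv.le,
    div_mul_cancel₀ _ c_pos.ne', Real.div_rpow hz.le hρ.le, Real.rpow_sub hρ]
  ring

theorem stmt_1 (vref γ κ vmin : ℝ)
    (hvref : 0 < vref) (hγ : 0 ≤ γ) (hκ : γ + 1 ≤ κ) :
    ConvexOn ℝ {q : ℝ × ℝ | 0 < q.1 ∧ 0 < q.2}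
      (fun q : ℝ × ℝ => q.1 * (vmin + press vref γ κ q.1 q.2)) := by
  have hfst : ConvexOn ℝ {q : ℝ × ℝ | 0 < q.1 ∧ 0 < q.2} (fun q => vmin * q.1) :=
    (vmin • LinearMap.fst ℝ ℝ ℝ).convexOn convex_posQuadrant
  rcases hγ.eq_or_lt with rfl | γ_pos
  · have hlog : ConvexOn ℝ {q : ℝ × ℝ | 0 < q.1 ∧ 0 < q.2}
        (fun q => q.1 * Real.log q.1) :=
      (Real.convexOn_mul_log.comp_linearMap (LinearMap.fst ℝ ℝ ℝ)).subset
        (fun q hq => hq.1.le) convex_posQuadrant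
    refine (hfst.add (hlog.smul hvref.le)).congr fun q _ => ?_
    simp only [Pi.add_apply, smul_eq_mul, press, lt_irrefl, if_false]
    ring
  · have hrpow := convexOn_rpow_mul_rpow_neg (κ := κ) (c := γ + 1) (by linarith) hκ
    refine (hfst.add (hrpow.smul (div_pos hvref γ_pos).le)).congr fun q hq => ?_
    simp only [Pi.add_apply, smul_eq_mul, press, if_pos γ_pos]
    rw [show γ + 1 - κ = γ - κ + 1 by ring, Real.rpow_add_one hq.1.ne']
    ring
end

section
/- For all positive reals ρ*, z*, ρ, z, the quantity h(ρ*,z*;ρ,z) := ρ·[p(ρ,z) − p(ρ*,z*)] + ρ*·[(ρ* − ρ)·p_ρ(ρ*,z*) + (z* − z)·p_z(ρ*,z*)] satisfies h(ρ*,z*;ρ,z) ≥ 0, and h(ρ,z;ρ,z) = 0. -/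
noncomputable def hfun (vref γ κ ρs zs ρ z : ℝ) : ℝ :=
  ρ * (press vref γ κ ρ z - press vref γ κ ρs zs) +
    ρs * ((ρs - ρ) * pRho vref γ κ ρs zs + (zs - z) * pZ vref γ κ ρs zs)

/-- The graph of `x ^ (-m) * y ^ κ` lies above its tangent plane at `(1, 1)`. -/
lemma tangent_le_rpow_neg_mul_rpow {m κ x y : ℝ} (hm : 0 ≤ m) (hκ : m + 1 ≤ κ)
    (hx : 0 < x) (hy : 0 < y) :
    1 - m * (x - 1) + κ * (y - 1) ≤ x ^ (-m) * y ^ κ := by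
  have hκ0 : 0 < κ := by linarith
  have hsum : 1 / κ + m / κ + (κ - m - 1) / κ = 1 := by field_simp; ring
  have amgm := Real.geom_mean_le_arith_mean3_weighted (w₁ := 1 / κ) (w₂ := m / κ)
    (w₃ := (κ - m - 1) / κ) (p₁ := x ^ (-m) * y ^ κ) (p₂ := x) (p₃ := 1)
    (by positivity) (by positivity) (div_nonneg (by linarith) hκ0.le)
    (by positivity) hx.le zero_le_one hsum
  have hgeom : (x ^ (-m) * y ^ κ) ^ (1 / κ) * x ^ (m / κ) * 1 ^ ((κ - m - 1) / κ) = y := by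
    rw [Real.one_rpow, mul_one, Real.mul_rpow (by positivity) (by positivity),
      ← Real.rpow_mul hx.le, ← Real.rpow_mul hy.le, mul_one_div_cancel hκ0.ne', Real.rpow_one,
      mul_right_comm, ← Real.rpow_add hx]
    rw [show -m * (1 / κ) + m / κ = 0 by ring, Real.rpow_zero, one_mul]
  rw [hgeom] at amgm
  have harith : κ * (1 / κ * (x ^ (-m) * y ^ κ) + m / κ * x + (κ - m - 1) / κ * 1)
      = x ^ (-m) * y ^ κ + m * x + (κ - m - 1) := by field_simp
  have := mul_le_mul_of_nonneg_left amgm hκ0.le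
  rw [harith] at this
  linarith

lemma hfun_self (vref γ κ ρ z : ℝ) : hfun vref γ κ ρ z ρ z = 0 := by
  simp [hfun]

lemma hfun_nonneg_of_not_pos {vref γ κ ρs zs ρ z : ℝ} (hvref : 0 ≤ vref) (hγ : ¬ 0 < γ)
    (hρs : 0 < ρs) (hρ : 0 < ρ) : 0 ≤ hfun vref γ κ ρs zs ρ z := by
  have hlog := Real.log_le_sub_one_of_pos (div_pos hρs hρ)
  rw [Real.log_div hρs.ne' hρ.ne'] at hlog
  have heq : hfun vref γ κ ρs zs ρ z
      = vref * (ρ * ((ρs / ρ - 1) - (Real.log ρs - Real.log ρ))) := by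
    simp only [hfun, press, pRho, pZ, if_neg hγ]
    field_simp
    ring
  rw [heq]
  exact mul_nonneg hvref (mul_nonneg hρ.le (sub_nonneg.2 hlog))

lemma hfun_mul_eq {vref γ κ ρs zs x y : ℝ} (hγ : 0 < γ) (hρs : 0 < ρs) (hzs : 0 < zs)
    (hx : 0 < x) (hy : 0 < y) :
    hfun vref γ κ ρs zs (ρs * x) (zs * y) = vref / γ * zs ^ κ * (ρs * ρs ^ (γ - κ)) *
      (x ^ (-(κ - γ - 1)) * y ^ κ - (1 - (κ - γ - 1) * (x - 1) + κ * (y - 1))) := by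
  simp only [hfun, press, pRho, pZ, if_pos hγ]
  rw [Real.mul_rpow hzs.le hy.le, Real.mul_rpow hρs.le hx.le, Real.rpow_sub_one hρs.ne',
    Real.rpow_sub_one hzs.ne', show -(κ - γ - 1) = (γ - κ) + 1 by ring, Real.rpow_add_one hx.ne']
  field_simp
  ring

lemma hfun_nonneg_of_pos {vref γ κ ρs zs ρ z : ℝ} (hvref : 0 ≤ vref) (hγ : 0 < γ)
    (hκ : γ + 1 ≤ κ) (hρs : 0 < ρs) (hzs : 0 < zs) (hρ : 0 < ρ) (hz : 0 < z) :
    0 ≤ hfun vref γ κ ρs zs ρ z := by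
  have hx : 0 < ρ / ρs := div_pos hρ hρs
  have hy : 0 < z / zs := div_pos hz hzs
  have heq := hfun_mul_eq (vref := vref) (κ := κ) hγ hρs hzs hx hy
  rw [mul_div_cancel₀ ρ hρs.ne', mul_div_cancel₀ z hzs.ne'] at heq
  rw [heq]
  exact mul_nonneg (by positivity)
    (sub_nonneg.2 (tangent_le_rpow_neg_mul_rpow (by linarith) (by linarith) hx hy))

theorem stmt_2 (vref γ κ : ℝ)
    (hvref : 0 < vref) (hγ : 0 ≤ γ) (hκ : γ + 1 ≤ κ)
    (ρs zs ρ z : ℝ) (hρs : 0 < ρs) (hzs : 0 < zs) (hρ : 0 < ρ) (hz : 0 < z) :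
    0 ≤ hfun vref γ κ ρs zs ρ z ∧ hfun vref γ κ ρ z ρ z = 0 := by
  refine ⟨?_, hfun_self vref γ κ ρ z⟩
  by_cases h : 0 < γ
  · exact hfun_nonneg_of_pos hvref.le h hκ hρs hzs hρ hz
  · exact hfun_nonneg_of_not_pos hvref.le h hρs hρ
end

section
/- Let U = (ρ,y,z) ∈ Ω1 with z > 0, and let α be a real number with α > v(U) > 0. Then both Lax–Friedrichs split states S±_LF(U) := U ± F(U)/α belong to Ω1. -/
theorem smul_mem_invariantDomain {wmin wmax cmin cmax : ℝ} {U : ℝ × ℝ × ℝ}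
    (hU : U ∈ {V : ℝ × ℝ × ℝ | 0 < V.1 ∧ wmin ≤ V.2.1 / V.1 ∧ V.2.1 / V.1 ≤ wmax ∧
        cmin ≤ V.2.2 / V.1 ∧ V.2.2 / V.1 ≤ cmax}) {t : ℝ} (ht : 0 < t) :
    t • U ∈ {V : ℝ × ℝ × ℝ | 0 < V.1 ∧ wmin ≤ V.2.1 / V.1 ∧ V.2.1 / V.1 ≤ wmax ∧
        cmin ≤ V.2.2 / V.1 ∧ V.2.2 / V.1 ≤ cmax} := by
  simpa only [Set.mem_ofPred_eq, Prod.smul_fst, Prod.smul_snd, smul_eq_mul,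
    mul_div_mul_left _ _ ht.ne', mul_pos_iff_of_pos_left ht] using hU

theorem stmt_3 (vref γ κ wmin wmax cmin cmax : ℝ)
    (hvref : 0 < vref) (hγ : 0 ≤ γ) (hκ : γ + 1 ≤ κ)
    (hw : wmin ≤ wmax) (hc : cmin ≤ cmax)
    (U : ℝ × ℝ × ℝ)
    (hU : U ∈ {V : ℝ × ℝ × ℝ | 0 < V.1 ∧ wmin ≤ V.2.1 / V.1 ∧ V.2.1 / V.1 ≤ wmax ∧
        cmin ≤ V.2.2 / V.1 ∧ V.2.2 / V.1 ≤ cmax})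
    (hz : 0 < U.2.2)
    (α : ℝ) (hαv : vel vref γ κ U < α) (hv : 0 < vel vref γ κ U) :
    U + α⁻¹ • flux vref γ κ U ∈ {V : ℝ × ℝ × ℝ | 0 < V.1 ∧ wmin ≤ V.2.1 / V.1 ∧
        V.2.1 / V.1 ≤ wmax ∧ cmin ≤ V.2.2 / V.1 ∧ V.2.2 / V.1 ≤ cmax} ∧
    U - α⁻¹ • flux vref γ κ U ∈ {V : ℝ × ℝ × ℝ | 0 < V.1 ∧ wmin ≤ V.2.1 / V.1 ∧
        V.2.1 / V.1 ≤ wmax ∧ cmin ≤ V.2.2 / V.1 ∧ V.2.2 / V.1 ≤ cmax} := by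
  have hα : 0 < α := hv.trans hαv
  have hpos : 0 < α⁻¹ * vel vref γ κ U := mul_pos (inv_pos.mpr hα) hv
  have hlt : α⁻¹ * vel vref γ κ U < 1 := (inv_mul_lt_one₀ hα).mpr hαv
  have hadd : U + α⁻¹ • flux vref γ κ U = (1 + α⁻¹ * vel vref γ κ U) • U := by
    rw [flux, smul_smul, add_smul, one_smul]
  have hsub : U - α⁻¹ • flux vref γ κ U = (1 - α⁻¹ * vel vref γ κ U) • U := by
    rw [flux, smul_smul, sub_smul, one_smul]
  rw [hadd, hsub]
  exact ⟨smul_mem_invariantDomain hU (by linarith), smul_mem_invariantDomain hU (by linarith)⟩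
end

section
/- (Geometric quasilinearization representation of Ω2.) The set Ω2 := {(ρ,y,z) ∈ ℝ³ : ρ > 0, z > 0, v(U) ≥ v_min} coincides with the set Ω2* := {(ρ,y,z) ∈ ℝ³ : ρ > 0, z > 0, and U · n(ρ*,z*) + s(ρ*,z*) ≥ 0 for all ρ* > 0 and z* > 0}, where · denotes the Euclidean dot product on ℝ³. -/
/-- Tangent inequality at `(1, 1)` for the convex function `(r, t) ↦ t ^ κ * r ^ (1 + γ - κ)`. -/
lemma mul_le_rpow_mul_rpow_add {γ κ r t : ℝ} (hγ : 0 ≤ γ) (hκ : γ + 1 ≤ κ)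
    (hr : 0 < r) (ht : 0 < t) :
    κ * t ≤ t ^ κ * r ^ (1 + γ - κ) + (κ - γ - 1) * r + γ := by
  have hκ0 : 0 < κ := by linarith
  have h := Real.geom_mean_le_arith_mean3_weighted (w₁ := 1 / κ) (w₂ := (κ - γ - 1) / κ)
    (w₃ := γ / κ) (p₁ := t ^ κ * r ^ (1 + γ - κ)) (p₂ := r) (p₃ := 1)
    (by positivity) (div_nonneg (by linarith) hκ0.le) (by positivity)
    (by positivity) hr.le zero_le_one (by field_simp; ring)
  have hgeom : (t ^ κ * r ^ (1 + γ - κ)) ^ (1 / κ) * r ^ ((κ - γ - 1) / κ) * 1 ^ (γ / κ) = t := by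
    rw [Real.mul_rpow (by positivity) (by positivity), ← Real.rpow_mul ht.le,
      ← Real.rpow_mul hr.le, Real.one_rpow, mul_one, mul_assoc, ← Real.rpow_add hr,
      mul_one_div_cancel hκ0.ne', Real.rpow_one]
    have : (1 + γ - κ) * (1 / κ) + (κ - γ - 1) / κ = 0 := by ring
    rw [this, Real.rpow_zero, mul_one]
  rw [hgeom] at h
  calc κ * t ≤ κ * (1 / κ * (t ^ κ * r ^ (1 + γ - κ)) + (κ - γ - 1) / κ * r + γ / κ * 1) :=
        mul_le_mul_of_nonneg_left h hκ0.le
    _ = _ := by field_simp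

/-- The function `(ρ, z) ↦ ρ * p(ρ, z)` lies above its tangent planes. -/
lemma tangent_le_mul_press {vref γ κ ρ z ρs zs : ℝ} (hvref : 0 < vref) (hγ : 0 ≤ γ)
    (hκ : γ + 1 ≤ κ) (hρ : 0 < ρ) (hz : 0 < z) (hρs : 0 < ρs) (hzs : 0 < zs) :
    ρ * (press vref γ κ ρs zs + ρs * pRho vref γ κ ρs zs) + z * (ρs * pZ vref γ κ ρs zs)
      - sfun vref γ κ ρs zs ≤ ρ * press vref γ κ ρ z := by
  unfold sfun press pRho pZ
  split_ifs with h
  · obtain ⟨r, hr, rfl⟩ : ∃ r, 0 < r ∧ ρ = ρs * r := ⟨ρ / ρs, by positivity, by field_simp⟩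
    obtain ⟨t, ht, rfl⟩ : ∃ t, 0 < t ∧ z = zs * t := ⟨z / zs, by positivity, by field_simp⟩
    have key := mul_le_rpow_mul_rpow_add hγ hκ hr ht
    rw [show 1 + γ - κ = (γ - κ) + 1 by ring, Real.rpow_add_one hr.ne'] at key
    rw [Real.rpow_sub_one hρs.ne', Real.rpow_sub_one hzs.ne', Real.mul_rpow hρs.le hr.le,
      Real.mul_rpow hzs.le ht.le]
    have hc : 0 ≤ vref / γ * ρs * zs ^ κ * ρs ^ (γ - κ) := by positivity
    have hmul := mul_le_mul_of_nonneg_left key hc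
    rw [← sub_nonneg] at hmul ⊢
    refine hmul.trans_eq ?_
    field_simp
    ring
  · have hlog := Real.log_le_sub_one_of_pos (div_pos hρs hρ)
    rw [Real.log_div hρs.ne' hρ.ne'] at hlog
    have hmul := mul_le_mul_of_nonneg_left hlog (mul_pos hvref hρ).le
    rw [← sub_nonneg] at hmul ⊢
    refine hmul.trans_eq ?_
    field_simp
    ring

theorem stmt_4 (vref γ κ vmin : ℝ)
    (hvref : 0 < vref) (hγ : 0 ≤ γ) (hκ : γ + 1 ≤ κ) :
    {U : ℝ × ℝ × ℝ | 0 < U.1 ∧ 0 < U.2.2 ∧ vmin ≤ vel vref γ κ U} =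
    {U : ℝ × ℝ × ℝ | 0 < U.1 ∧ 0 < U.2.2 ∧
      ∀ ρs zs : ℝ, 0 < ρs → 0 < zs →
        0 ≤ dot3 U (nvec vref γ κ vmin ρs zs) + sfun vref γ κ ρs zs} := by
  ext ⟨ρ, y, z⟩
  simp only [Set.mem_ofPred_eq]
  refine and_congr_right fun hρ => and_congr_right fun hz => ?_
  have hvel : vmin ≤ vel vref γ κ (ρ, y, z) ↔ 0 ≤ y - ρ * vmin - ρ * press vref γ κ ρ z := by
    simp only [vel]
    rw [le_sub_iff_add_le, le_div_iff₀ hρ, ← sub_nonneg]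
    ring_nf
  rw [hvel]
  simp only [dot3, nvec]
  constructor
  · intro h ρs zs hρs hzs
    linarith [tangent_le_mul_press hvref hγ hκ hρ hz hρs hzs]
  · intro h
    have h' := h ρ z hρ hz
    simp only [sfun] at h'
    linarith
end

section
/- For every state U = (ρ,y,z) ∈ ℝ³ with ρ > 0 and z > 0, and all ρ* > 0, z* > 0, it holds that U · n(ρ*,z*) + s(ρ*,z*) ≥ ρ·(v(U) − v_min), where · denotes the Euclidean dot product on ℝ³. -/
/-- Weighted AM-GM: the tangent plane at `(1, 1)` of `(x, w) ↦ x * (w ^ κ * x ^ (γ - κ))`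
lies below its graph. -/
theorem tangent_le_rpow_mul_rpow {γ κ x w : ℝ} (hγ : 0 ≤ γ) (hκ : γ + 1 ≤ κ)
    (hx : 0 < x) (hw : 0 < w) :
    κ * w - (κ - 1 - γ) * x - γ ≤ x * (w ^ κ * x ^ (γ - κ)) := by
  have hκ0 : 0 < κ := by linarith
  have hq : 0 < x * (w ^ κ * x ^ (γ - κ)) := by positivity
  have amgm := Real.geom_mean_le_arith_mean3_weighted
    (w₁ := 1 / κ) (w₂ := (κ - 1 - γ) / κ) (w₃ := γ / κ)
    (p₁ := x * (w ^ κ * x ^ (γ - κ))) (p₂ := x) (p₃ := 1)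
    (by positivity) (div_nonneg (by linarith) hκ0.le) (by positivity)
    hq.le hx.le zero_le_one (by field_simp; ring)
  have hprod : (x * (w ^ κ * x ^ (γ - κ))) ^ (1 / κ) * x ^ ((κ - 1 - γ) / κ)
      * (1 : ℝ) ^ (γ / κ) = w := by
    have hwpow : (w ^ κ) ^ (1 / κ) = w := by
      rw [← Real.rpow_mul hw.le, mul_one_div_cancel hκ0.ne', Real.rpow_one]
    rw [Real.one_rpow, mul_one, Real.mul_rpow hx.le (by positivity),
      Real.mul_rpow (by positivity) (by positivity), hwpow, ← Real.rpow_mul hx.le]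
    calc x ^ (1 / κ) * (w * x ^ ((γ - κ) * (1 / κ))) * x ^ ((κ - 1 - γ) / κ)
        = w * (x ^ (1 / κ) * x ^ ((γ - κ) * (1 / κ)) * x ^ ((κ - 1 - γ) / κ)) := by ring
      _ = w * x ^ (1 / κ + (γ - κ) * (1 / κ) + (κ - 1 - γ) / κ) := by
        rw [Real.rpow_add hx, Real.rpow_add hx]
      _ = w := by
        rw [show 1 / κ + (γ - κ) * (1 / κ) + (κ - 1 - γ) / κ = 0 by ring,
          Real.rpow_zero, mul_one]
  rw [hprod] at amgm
  have hmul := mul_le_mul_of_nonneg_left amgm hκ0.le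
  have hsum : κ * (1 / κ * (x * (w ^ κ * x ^ (γ - κ))) + (κ - 1 - γ) / κ * x + γ / κ * 1)
      = x * (w ^ κ * x ^ (γ - κ)) + (κ - 1 - γ) * x + γ := by
    field_simp
  linarith

theorem stmt_5 (vref γ κ vmin : ℝ)
    (hvref : 0 < vref) (hγ : 0 ≤ γ) (hκ : γ + 1 ≤ κ)
    (U : ℝ × ℝ × ℝ) (hρ : 0 < U.1) (hz : 0 < U.2.2)
    (ρs zs : ℝ) (hρs : 0 < ρs) (hzs : 0 < zs) :
    U.1 * (vel vref γ κ U - vmin) ≤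
      dot3 U (nvec vref γ κ vmin ρs zs) + sfun vref γ κ ρs zs := by
  obtain ⟨ρ, y, z⟩ := U
  dsimp only at hρ hz
  have hy : ρ * (y / ρ) = y := mul_div_cancel₀ y hρ.ne'
  rcases hγ.lt_or_eq with hpos | rfl
  · simp only [vel, dot3, nvec, sfun, press, pRho, pZ, if_pos hpos]
    obtain ⟨x, hx, rfl⟩ : ∃ x, 0 < x ∧ ρ = ρs * x :=
      ⟨ρ / ρs, div_pos hρ hρs, (mul_div_cancel₀ ρ hρs.ne').symm⟩
    obtain ⟨w, hw, rfl⟩ : ∃ w, 0 < w ∧ z = zs * w :=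
      ⟨z / zs, div_pos hz hzs, (mul_div_cancel₀ z hzs.ne').symm⟩
    rw [Real.mul_rpow hzs.le hw.le, Real.mul_rpow hρs.le hx.le,
      Real.rpow_sub_one hρs.ne', Real.rpow_sub_one hzs.ne']
    have key := tangent_le_rpow_mul_rpow hγ hκ hx hw
    have hc : 0 ≤ vref / γ * (ρs * (zs ^ κ * ρs ^ (γ - κ))) := by positivity
    have hscaled := mul_le_mul_of_nonneg_left key hc
    rw [mul_sub, mul_sub, hy]
    generalize zs ^ κ = A at *
    generalize ρs ^ (γ - κ) = B at *
    generalize w ^ κ = C at *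
    generalize x ^ (γ - κ) = D at *
    generalize vref / γ = c at *
    have hB : ρs * (B / ρs) = B := mul_div_cancel₀ B hρs.ne'
    have hA : zs * (A / zs) = A := mul_div_cancel₀ A hzs.ne'
    generalize B / ρs = B' at *
    generalize A / zs = A' at *
    subst hA hB
    linarith
  · simp only [vel, dot3, nvec, sfun, press, pRho, pZ, if_neg (lt_irrefl (0 : ℝ))]
    have hlog := Real.log_le_sub_one_of_pos (div_pos hρs hρ)
    rw [Real.log_div hρs.ne' hρ.ne'] at hlog
    have hscaled := mul_le_mul_of_nonneg_left hlog (mul_pos hvref hρ).le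
    have hquot : ρ * (ρs / ρ) = ρs := mul_div_cancel₀ ρs hρ.ne'
    have hv : ρs * (vref / ρs) = vref := mul_div_cancel₀ vref hρs.ne'
    have hrhs : vref * ρ * (ρs / ρ - 1) = vref * ρs - vref * ρ := by
      rw [mul_sub, mul_assoc, hquot, mul_one]
    rw [hrhs] at hscaled
    rw [mul_sub, mul_sub, hy, hv, sq, mul_assoc ρs ρs, hv]
    linarith
end

section
/- Let U = (ρ,y,z) ∈ ℝ³ with ρ > 0, z > 0, and v(U) ≥ v_min. Then for all ρ* > 0, z* > 0 and for each sign σ ∈ {+1, −1}, the inequality σ·(F(U) · n(ρ*,z*) + v_min·s(ρ*,z*)) ≤ (|v(U)| + s(ρ*,z*)/ρ) · (U · n(ρ*,z*) + s(ρ*,z*)) holds, where · between vectors denotes the Euclidean dot product on ℝ³. -/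
/-- Weighted AM-GM form of the tangent-plane inequality at `(1, 1)` for `t ^ κ * r ^ (γ - κ + 1)`. -/
theorem weighted_tangent_le {γ κ r t : ℝ} (hγ : 0 < γ) (hκ : γ + 1 ≤ κ) (hr : 0 < r) (ht : 0 < t) :
    κ * t ≤ r * (t ^ κ * r ^ (γ - κ)) + (κ - γ - 1) * r + γ := by
  have hκ0 : 0 < κ := by linarith
  have key := Real.geom_mean_le_arith_mean3_weighted (w₁ := 1 / κ) (w₂ := (κ - γ - 1) / κ)
    (w₃ := γ / κ) (p₁ := t ^ κ * r ^ (γ - κ + 1)) (p₂ := r) (p₃ := 1) (by positivity)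
    (div_nonneg (by linarith) hκ0.le) (by positivity) (by positivity) hr.le zero_le_one
    (by field_simp; ring)
  have hprod : (t ^ κ * r ^ (γ - κ + 1)) ^ (1 / κ) * r ^ ((κ - γ - 1) / κ) * 1 ^ (γ / κ) = t := by
    rw [Real.mul_rpow (by positivity) (by positivity), ← Real.rpow_mul ht.le,
      ← Real.rpow_mul hr.le, Real.one_rpow, mul_one, mul_assoc, ← Real.rpow_add hr,
      show κ * (1 / κ) = 1 by field_simp,
      show (γ - κ + 1) * (1 / κ) + (κ - γ - 1) / κ = 0 by field_simp; ring,
      Real.rpow_one, Real.rpow_zero, mul_one]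
  rw [hprod, Real.rpow_add hr, Real.rpow_one] at key
  have hmul := mul_le_mul_of_nonneg_left key hκ0.le
  have hexp : κ * (1 / κ * (t ^ κ * (r ^ (γ - κ) * r)) + (κ - γ - 1) / κ * r + γ / κ * 1) =
      r * (t ^ κ * r ^ (γ - κ)) + (κ - γ - 1) * r + γ := by
    field_simp
  linarith

/-- The tangent-plane inequality for the convex function `ρ * p(ρ, z)`. -/
theorem mul_press_tangent_nonneg {vref γ κ ρ z ρs zs : ℝ} (hvref : 0 < vref)
    (hκ : γ + 1 ≤ κ) (hρ : 0 < ρ) (hz : 0 < z) (hρs : 0 < ρs) (hzs : 0 < zs) :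
    0 ≤ ρ * (press vref γ κ ρ z - press vref γ κ ρs zs - ρs * pRho vref γ κ ρs zs)
      - z * (ρs * pZ vref γ κ ρs zs) + sfun vref γ κ ρs zs := by
  unfold sfun press pRho pZ
  split_ifs with h
  · obtain ⟨r, hr, rfl⟩ : ∃ r, 0 < r ∧ ρ = r * ρs := ⟨ρ / ρs, by positivity, by field_simp⟩
    obtain ⟨t, ht, rfl⟩ : ∃ t, 0 < t ∧ z = t * zs := ⟨z / zs, by positivity, by field_simp⟩
    rw [Real.mul_rpow ht.le hzs.le, Real.mul_rpow hr.le hρs.le, Real.rpow_sub_one hρs.ne',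
      Real.rpow_sub_one hzs.ne']
    have hpos : 0 < ρs * (vref / γ * zs ^ κ * ρs ^ (γ - κ)) := by positivity
    have hnonneg := mul_nonneg hpos.le (sub_nonneg.2 (weighted_tangent_le h hκ hr ht))
    refine hnonneg.trans_eq ?_
    field_simp
    ring
  · have hlog := Real.log_le_sub_one_of_pos (div_pos hρs hρ)
    rw [Real.log_div hρs.ne' hρ.ne'] at hlog
    have hnonneg := mul_nonneg (mul_pos hvref hρ).le (sub_nonneg.2 hlog)
    refine hnonneg.trans_eq ?_
    field_simp
    ring

theorem sfun_nonneg {vref γ κ ρ z : ℝ} (hvref : 0 < vref) (hρ : 0 < ρ) (hz : 0 < z) :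
    0 ≤ sfun vref γ κ ρ z := by
  unfold sfun pRho pZ
  split_ifs with h
  · rw [Real.rpow_sub_one hρ.ne', Real.rpow_sub_one hz.ne']
    have hnonneg : 0 ≤ vref * ρ * z ^ κ * ρ ^ (γ - κ) := by positivity
    refine hnonneg.trans_eq ?_
    field_simp
    ring
  · positivity

theorem stmt_6 (vref γ κ vmin : ℝ)
    (hvref : 0 < vref) (hγ : 0 ≤ γ) (hκ : γ + 1 ≤ κ)
    (U : ℝ × ℝ × ℝ) (hρ : 0 < U.1) (hz : 0 < U.2.2) (hv : vmin ≤ vel vref γ κ U)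
    (ρs zs : ℝ) (hρs : 0 < ρs) (hzs : 0 < zs)
    (σ : ℝ) (hσ : σ = 1 ∨ σ = -1) :
    σ * (dot3 (flux vref γ κ U) (nvec vref γ κ vmin ρs zs) + vmin * sfun vref γ κ ρs zs) ≤
      (|vel vref γ κ U| + sfun vref γ κ ρs zs / U.1) *
        (dot3 U (nvec vref γ κ vmin ρs zs) + sfun vref γ κ ρs zs) := by
  have hH := mul_press_tangent_nonneg hvref hκ hρ hz hρs hzs
  have hs : 0 ≤ sfun vref γ κ ρs zs := sfun_nonneg hvref hρs hzs
  have hy : U.2.1 = U.1 * (vel vref γ κ U + press vref γ κ U.1 U.2.2) := by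
    unfold vel
    field_simp
    ring
  simp only [dot3, flux, nvec, Prod.smul_fst, Prod.smul_snd, smul_eq_mul]
  rw [hy]
  set v := vel vref γ κ U
  set s := sfun vref γ κ ρs zs
  set p := press vref γ κ U.1 U.2.2
  set q := vmin + press vref γ κ ρs zs + ρs * pRho vref γ κ ρs zs with hq
  set g := U.1 * -q + U.1 * (v + p) * 1 + U.2.2 * -(ρs * pZ vref γ κ ρs zs) + s with hg
  have hgv : U.1 * (v - vmin) ≤ g := by
    rw [hg, hq]
    linarith
  have hg0 : 0 ≤ g := (mul_nonneg hρ.le (sub_nonneg.2 hv)).trans hgv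
  have hsg : s * (v - vmin) ≤ s / U.1 * g := by
    calc s * (v - vmin) = s / U.1 * (U.1 * (v - vmin)) := by field_simp
      _ ≤ s / U.1 * g := mul_le_mul_of_nonneg_left hgv (by positivity)
  have hsv : 0 ≤ s * (v - vmin) := mul_nonneg hs (sub_nonneg.2 hv)
  have hflux : v * U.1 * -q + v * (U.1 * (v + p)) * 1
      + v * U.2.2 * -(ρs * pZ vref γ κ ρs zs) + vmin * s = v * g - s * (v - vmin) := by
    rw [hg]
    ring
  have habs := mul_le_mul_of_nonneg_right (le_abs_self v) hg0
  have hneg := mul_le_mul_of_nonneg_right (neg_le_abs v) hg0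
  rcases hσ with rfl | rfl <;> linarith
end

section
/- Let Û = (ρ̂,ŷ,ẑ) and Ǔ = (ρ̌,y̌,ž) be states with ρ̂, ẑ, ρ̌, ž > 0 and v̂ := v(Û) ≥ 0, v̌ := v(Ǔ) ≥ 0 (so that α_std > 0). For any real α ≥ α_std, define ρ̂ᶜ := ½[ρ̂(1 + v̂/α) + ρ̌(1 − v̌/α)] and ẑᶜ := ½[ẑ(1 + v̂/α) + ž(1 − v̌/α)] (these are the first and third components of S_GLF(Û,Ǔ)). Then ρ̂ᶜ ∈ [ρ̲, ρ̄] and ẑᶜ ∈ [z̲, z̄]; consequently s(ρ̂ᶜ, ẑᶜ) ≤ s̄. -/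
lemma pRho_add_pZ_pos {vref γ κ ρ z : ℝ} (hvref : 0 < vref) (hρ : 0 < ρ) (hz : 0 < z) :
    0 < ρ * pRho vref γ κ ρ z + z * pZ vref γ κ ρ z := by
  unfold pRho pZ
  split_ifs with h
  · have h1 : ρ ^ (γ - κ) = ρ * ρ ^ (γ - κ - 1) := by
      rw [Real.rpow_sub_one hρ.ne']
      field_simp
    have h2 : z ^ κ = z * z ^ (κ - 1) := by
      rw [Real.rpow_sub_one hz.ne']
      field_simp
    have h3 : ρ * (vref / γ * (γ - κ) * z ^ κ * ρ ^ (γ - κ - 1)) +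
        z * (vref / γ * κ * z ^ (κ - 1) * ρ ^ (γ - κ)) =
        vref * (z * z ^ (κ - 1)) * (ρ * ρ ^ (γ - κ - 1)) := by
      rw [h1, h2]
      field_simp
      ring
    rw [h3]
    positivity
  · simp only [mul_zero, add_zero]
    positivity

lemma vel_lt_abar {vref γ κ : ℝ} {U : ℝ × ℝ × ℝ} (hvref : 0 < vref)
    (hρ : 0 < U.1) (hz : 0 < U.2.2) : vel vref γ κ U < abar vref γ κ U :=
  lt_add_of_pos_right _ (abs_pos.2 (pRho_add_pZ_pos hvref hρ hz).ne')

lemma continuousOn_sfun (vref γ κ : ℝ) :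
    ContinuousOn (fun q : ℝ × ℝ => sfun vref γ κ q.1 q.2) (Set.Ioi 0 ×ˢ Set.Ioi 0) := by
  rintro ⟨ρ, z⟩ ⟨hρ, hz⟩
  have hρ0 : ρ ≠ 0 := ne_of_gt hρ
  have hz0 : z ≠ 0 := ne_of_gt hz
  have hfst (r : ℝ) : ContinuousAt (fun q : ℝ × ℝ => q.1 ^ r) (ρ, z) :=
    continuousAt_fst.rpow_const (Or.inl hρ0)
  have hsnd (r : ℝ) : ContinuousAt (fun q : ℝ × ℝ => q.2 ^ r) (ρ, z) :=
    continuousAt_snd.rpow_const (Or.inl hz0)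
  refine ContinuousAt.continuousWithinAt ?_
  unfold sfun pRho pZ
  split_ifs
  · exact ((continuousAt_fst.pow 2).mul ((continuousAt_const.mul (hsnd κ)).mul (hfst _))).add
      ((continuousAt_fst.mul continuousAt_snd).mul
        ((continuousAt_const.mul (hsnd _)).mul (hfst _)))
  · exact ((continuousAt_fst.pow 2).mul (continuousAt_const.div continuousAt_fst hρ0)).add
      ((continuousAt_fst.mul continuousAt_snd).mul continuousAt_const)

lemma add_div_mem_uIcc {x d a α : ℝ} (ha : 0 < a) (haα : a ≤ α) :
    x + d / (2 * α) ∈ Set.uIcc x (x + d / (2 * a)) := by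
  have hα : 0 < α := ha.trans_le haα
  rw [Set.mem_uIcc]
  rcases le_total 0 d with hd | hd
  · left
    constructor
    · have : 0 ≤ d / (2 * α) := by positivity
      linarith
    · gcongr
  · right
    have h1 : -d / (2 * α) ≤ -d / (2 * a) := by
      have : 0 ≤ -d := by linarith
      gcongr
    have h2 : 0 ≤ -d / (2 * α) := div_nonneg (by linarith) (by positivity)
    rw [neg_div] at h1 h2
    rw [neg_div] at h1
    constructor <;> linarith

lemma half_sum_eq {x y v w α : ℝ} :
    (x * (1 + v / α) + y * (1 - w / α)) / 2 = (x + y) / 2 + (x * v - y * w) / (2 * α) := by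
  rw [mul_comm (2 : ℝ) α, ← div_div]
  ring

lemma half_sum_pos {x y v w a : ℝ} (hx : 0 < x) (hy : 0 < y) (hv : 0 ≤ v) (ha : 0 < a)
    (hw : w < a) : 0 < (x + y) / 2 + (x * v - y * w) / (2 * a) := by
  rw [← half_sum_eq]
  have h1 : w / a < 1 := (div_lt_one ha).2 hw
  have h2 : 0 ≤ v / a := by positivity
  have h3 : 0 < y * (1 - w / a) := mul_pos hy (by linarith)
  positivity

theorem stmt_8 (vref γ κ : ℝ)
    (hvref : 0 < vref) (hγ : 0 ≤ γ) (hκ : γ + 1 ≤ κ)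
    (Uh Uc : ℝ × ℝ × ℝ)
    (hρh : 0 < Uh.1) (hzh : 0 < Uh.2.2) (hρc : 0 < Uc.1) (hzc : 0 < Uc.2.2)
    (hvh : 0 ≤ vel vref γ κ Uh) (hvc : 0 ≤ vel vref γ κ Uc)
    (α : ℝ) (hα : astd vref γ κ Uh Uc ≤ α) :
    (Uh.1 * (1 + vel vref γ κ Uh / α) + Uc.1 * (1 - vel vref γ κ Uc / α)) / 2 ∈
      Set.Icc (min (rho1 Uh Uc) (rho2 vref γ κ Uh Uc))
              (max (rho1 Uh Uc) (rho2 vref γ κ Uh Uc)) ∧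
    (Uh.2.2 * (1 + vel vref γ κ Uh / α) + Uc.2.2 * (1 - vel vref γ κ Uc / α)) / 2 ∈
      Set.Icc (min (zet1 Uh Uc) (zet2 vref γ κ Uh Uc))
              (max (zet1 Uh Uc) (zet2 vref γ κ Uh Uc)) ∧
    sfun vref γ κ
        ((Uh.1 * (1 + vel vref γ κ Uh / α) + Uc.1 * (1 - vel vref γ κ Uc / α)) / 2)
        ((Uh.2.2 * (1 + vel vref γ κ Uh / α) + Uc.2.2 * (1 - vel vref γ κ Uc / α)) / 2) ≤
      sbar vref γ κ Uh Uc := by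
  have hvh' := (vel_lt_abar (γ := γ) (κ := κ) hvref hρh hzh).trans_le
    (le_max_left _ (abar vref γ κ Uc))
  have hvc' := (vel_lt_abar (γ := γ) (κ := κ) hvref hρc hzc).trans_le
    (le_max_right (abar vref γ κ Uh) _)
  have ha : 0 < astd vref γ κ Uh Uc := hvh.trans_lt hvh'
  have hρ : (Uh.1 * (1 + vel vref γ κ Uh / α) + Uc.1 * (1 - vel vref γ κ Uc / α)) / 2 ∈
      Set.Icc (min (rho1 Uh Uc) (rho2 vref γ κ Uh Uc))
        (max (rho1 Uh Uc) (rho2 vref γ κ Uh Uc)) := by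
    rw [half_sum_eq]
    exact add_div_mem_uIcc ha hα
  have hz : (Uh.2.2 * (1 + vel vref γ κ Uh / α) + Uc.2.2 * (1 - vel vref γ κ Uc / α)) / 2 ∈
      Set.Icc (min (zet1 Uh Uc) (zet2 vref γ κ Uh Uc))
        (max (zet1 Uh Uc) (zet2 vref γ κ Uh Uc)) := by
    rw [half_sum_eq]
    exact add_div_mem_uIcc ha hα
  refine ⟨hρ, hz, ?_⟩
  have hρ_pos : 0 < min (rho1 Uh Uc) (rho2 vref γ κ Uh Uc) :=
    lt_min (half_pos (add_pos hρh hρc)) (half_sum_pos hρh hρc hvh ha hvc')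
  have hz_pos : 0 < min (zet1 Uh Uc) (zet2 vref γ κ Uh Uc) :=
    lt_min (half_pos (add_pos hzh hzc)) (half_sum_pos hzh hzc hvh ha hvc')
  refine le_csSup (IsCompact.bddAbove_image (isCompact_Icc.prod isCompact_Icc)
    ((continuousOn_sfun vref γ κ).mono ?_)) ⟨(_, _), ⟨hρ, hz⟩, rfl⟩
  exact Set.prod_mono (fun _ h => hρ_pos.trans_le h.1) (fun _ h => hz_pos.trans_le h.1)
end
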